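/- Fix an integer r ≥ 1 and integers p, q. If ℰ^{p-r,q+r-1}_r = ∅, then β_{p,q,r} is an isomorphism. -/

import Mathlib

open Submodule

/-- A double complex of `k`-vector spaces: `A = ⊕_{p,q ∈ ℤ} A^{p,q}` with `A^{p,q} = 0`
for `p < 0` or `q < 0`, with anticommuting differentials `d' : A^{p,q} → A^{p+1,q}` and
`d'' : A^{p,q} → A^{p,q+1}` squaring to zero. -/
structure DoubleComplex (k : Type*) [Field k] (V : Type*) [AddCommGroup V] [Module k V] where
  A : ℤ → ℤ → Submodule k V
  isInternal : DirectSum.IsInternal (fun pq : ℤ × ℤ => A pq.1 pq.2)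
  vanish : ∀ p q : ℤ, p < 0 ∨ q < 0 → A p q = ⊥
  d' : V →ₗ[k] V
  d'' : V →ₗ[k] V
  mapA_d' : ∀ p q : ℤ, (A p q).map d' ≤ A (p + 1) q
  mapA_d'' : ∀ p q : ℤ, (A p q).map d'' ≤ A p (q + 1)
  d'_d' : d' ∘ₗ d' = 0
  d''_d'' : d'' ∘ₗ d'' = 0
  anticomm : d' ∘ₗ d'' + d'' ∘ₗ d' = 0

namespace DoubleComplex

variable {k : Type*} [Field k] {V : Type*} [AddCommGroup V] [Module k V]
variable (C : DoubleComplex k V)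

/-- The total differential `d = d' + d''`. -/
def dTot : V →ₗ[k] V := C.d' + C.d''

lemma dd_apply (x : V) : C.dTot (C.dTot x) = 0 := by
  have h1 := LinearMap.ext_iff.mp C.d'_d' x
  have h2 := LinearMap.ext_iff.mp C.d''_d'' x
  have h3 := LinearMap.ext_iff.mp C.anticomm x
  simp only [LinearMap.comp_apply, LinearMap.zero_apply, LinearMap.add_apply] at h1 h2 h3
  simp only [dTot, LinearMap.add_apply, map_add]
  rw [h1, h2, zero_add, add_zero, add_comm]
  exact h3

/-- The filtration `F^p A^n = ⊕_{s ≥ p} A^{s, n-s}`. -/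
def F (p n : ℤ) : Submodule k V := ⨆ (s : ℤ) (_ : p ≤ s), C.A s (n - s)

lemma F_antitone {p p' : ℤ} (h : p ≤ p') (n : ℤ) : C.F p' n ≤ C.F p n :=
  biSup_mono fun s hs => le_trans h hs

/-- `Z^{p,q}_r = {ξ ∈ F^p A^{p+q} : dξ ∈ F^{p+r} A^{p+q+1}}`. -/
def Z (p q r : ℤ) : Submodule k V :=
  C.F p (p + q) ⊓ (C.F (p + r) (p + q + 1)).comap C.dTot

/-- `Z^{p,q}_∞ = F^p A^{p+q} ∩ ker d`. -/
def Zinf (p q : ℤ) : Submodule k V := C.F p (p + q) ⊓ LinearMap.ker C.dTot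

/-- `B^{p,q}_r = F^p A^{p+q} ∩ d(F^{p-r} A^{p+q-1})`. -/
def B (p q r : ℤ) : Submodule k V :=
  C.F p (p + q) ⊓ (C.F (p - r) (p + q - 1)).map C.dTot

/-- `B^{p,q}_∞ = F^p A^{p+q} ∩ im d`. -/
def Binf (p q : ℤ) : Submodule k V := C.F p (p + q) ⊓ LinearMap.range C.dTot

lemma B_mono (p q : ℤ) {r r' : ℤ} (h : r ≤ r') : C.B p q r ≤ C.B p q r' :=
  inf_le_inf le_rfl (Submodule.map_mono (C.F_antitone (by omega) _))

lemma Z_anti (p q : ℤ) {r r' : ℤ} (h : r' ≤ r) : C.Z p q r ≤ C.Z p q r' :=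
  inf_le_inf le_rfl (Submodule.comap_mono (C.F_antitone (by omega) _))

/-- The denominator `Z^{p+1,q-1}_{r-1} + B^{p,q}_{r-1}` of `E^{p,q}_r`. -/
def Eden (p q r : ℤ) : Submodule k V := C.Z (p + 1) (q - 1) (r - 1) ⊔ C.B p q (r - 1)

/-- `E^{p,q}_r = Z^{p,q}_r / (Z^{p+1,q-1}_{r-1} + B^{p,q}_{r-1})`. -/
abbrev E (p q r : ℤ) :=
  C.Z p q r ⧸ (C.Eden p q r).comap (C.Z p q r).subtype

/-- The common target `Z^{p,q}_r / (Z^{p+1,q-1}_{r-1} + B^{p,q}_r)` of `α_{p,q,r}` and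
`β_{p,q,r}`. -/
abbrev T (p q r : ℤ) :=
  C.Z p q r ⧸ (C.Z (p + 1) (q - 1) (r - 1) ⊔ C.B p q r).comap (C.Z p q r).subtype

/-- `β_{p,q,r} : E^{p,q}_r → Z^{p,q}_r/(Z^{p+1,q-1}_{r-1} + B^{p,q}_r)`, induced by the
identity of `Z^{p,q}_r`. -/
def beta (p q r : ℤ) : C.E p q r →ₗ[k] C.T p q r :=
  Submodule.mapQ _ _ LinearMap.id (by
    intro x hx
    simp only [Submodule.mem_comap, LinearMap.id_coe, id_eq] at hx ⊢
    exact sup_le_sup_left (C.B_mono p q (by omega)) _ hx)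

/-- `α_{p,q,r} : E^{p,q}_{r+1} → Z^{p,q}_r/(Z^{p+1,q-1}_{r-1} + B^{p,q}_r)`, induced by the
inclusion `Z^{p,q}_{r+1} ⊆ Z^{p,q}_r`. -/
def alpha (p q r : ℤ) : C.E p q (r + 1) →ₗ[k] C.T p q r :=
  Submodule.mapQ _ _ (Submodule.inclusion (C.Z_anti p q (by omega : r ≤ r + 1))) (by
    rw [← Submodule.comap_comp, Submodule.subtype_comp_inclusion]
    exact Submodule.comap_mono
      (sup_le_sup (C.Z_anti _ _ (by omega)) (C.B_mono _ _ (by omega))))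

lemma d_Z (p q r : ℤ) : ∀ x ∈ C.Z p q r, C.dTot x ∈ C.Z (p + r) (q - r + 1) r := by
  intro x hx
  rw [Z, Submodule.mem_inf] at hx ⊢
  obtain ⟨hx1, hx2⟩ := hx
  constructor
  · rw [show p + r + (q - r + 1) = p + q + 1 by ring]
    exact hx2
  · rw [Submodule.mem_comap, C.dd_apply]
    exact zero_mem _

lemma d_Eden (p q r : ℤ) : ∀ x ∈ C.Eden p q r, C.dTot x ∈ C.Eden (p + r) (q - r + 1) r := by
  intro x hx
  rw [Eden, Submodule.mem_sup] at hx
  obtain ⟨y, hy, z, hz, rfl⟩ := hx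
  rw [map_add]
  apply add_mem
  · apply Submodule.mem_sup_right
    rw [Z, Submodule.mem_inf] at hy
    obtain ⟨hy1, hy2⟩ := hy
    rw [Submodule.mem_comap] at hy2
    rw [B, Submodule.mem_inf]
    have e1 : (p + 1 + (r - 1) : ℤ) = p + r := by ring
    have e2 : (p + 1 + (q - 1) + 1 : ℤ) = p + r + (q - r + 1) := by ring
    have e3 : (p + 1 + (q - 1) : ℤ) = p + r + (q - r + 1) - 1 := by ring
    rw [e1, e2] at hy2
    rw [e3] at hy1
    refine ⟨hy2, ?_⟩
    rw [show (p + r - (r - 1) : ℤ) = p + 1 by ring]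
    exact Submodule.mem_map_of_mem hy1
  · rw [B, Submodule.mem_inf] at hz
    obtain ⟨hz1, hz2⟩ := hz
    rw [Submodule.mem_map] at hz2
    obtain ⟨w, hw, rfl⟩ := hz2
    rw [C.dd_apply]
    exact zero_mem _

/-- The restriction of the total differential to `Z^{p,q}_r → Z^{p+r,q-r+1}_r`. -/
def drAux (p q r : ℤ) : C.Z p q r →ₗ[k] C.Z (p + r) (q - r + 1) r :=
  C.dTot.restrict (C.d_Z p q r)

/-- The induced differential `d_r : E^{p,q}_r → E^{p+r,q-r+1}_r`. -/
def dr (p q r : ℤ) : C.E p q r →ₗ[k] C.E (p + r) (q - r + 1) r :=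
  Submodule.mapQ _ _ (C.drAux p q r) (by
    rw [drAux, ← Submodule.comap_comp, LinearMap.subtype_comp_restrict]
    show (C.Eden p q r).comap (C.Z p q r).subtype ≤
      (C.Eden (p + r) (q - r + 1) r).comap (C.dTot ∘ₗ (C.Z p q r).subtype)
    rw [Submodule.comap_comp]
    exact Submodule.comap_mono fun x hx => C.d_Eden p q r x hx)

/-- The set `ℰ^{p,q}_r`: for `r ≥ 1` it consists of the elements
`ξ = ξ_0 + ⋯ + ξ_{r-1}` with `ξ_i ∈ A^{p+i,q-i}` such that `dξ = d'ξ_{r-1}`,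
`d'ξ_{r-1} ∉ im d''`, and `ξ_0` is not the leading term of any `d`-closed element
(no `d`-closed `η ∈ F^p A^{p+q}` has component `ξ_0` in `A^{p,q}`, i.e. `η - ξ_0 ∈ F^{p+1}`);
and `ℰ^{p,q}_0 = B^{p,q+1}_0 \ (Z^{p+1,q}_{-1} + B^{p,q+1}_{-1})`. -/
def scrE (p q r : ℤ) : Set V :=
  if 1 ≤ r then
    {ξ | ∃ c : ℕ → V, (∀ i : ℕ, c i ∈ C.A (p + i) (q - i)) ∧
        ξ = ∑ i ∈ Finset.range r.toNat, c i ∧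
        C.dTot ξ = C.d' (c (r.toNat - 1)) ∧
        C.d' (c (r.toNat - 1)) ∉ LinearMap.range C.d'' ∧
        ¬∃ η, η ∈ C.F p (p + q) ∧ C.dTot η = 0 ∧ η - c 0 ∈ C.F (p + 1) (p + q)}
  else
    (C.B p (q + 1) 0 : Set V) \ ((C.Z (p + 1) q (-1) ⊔ C.B p (q + 1) (-1) : Submodule k V) : Set V)

/-- The double complex satisfies the `d'd''`-lemma:
`im d' ∩ ker d'' ∩ A^{p,q} = ker d' ∩ im d'' ∩ A^{p,q} = im (d'd'') ∩ A^{p,q}` for all `p, q`. -/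
def DDLemma : Prop :=
  ∀ p q : ℤ,
    LinearMap.range C.d' ⊓ LinearMap.ker C.d'' ⊓ C.A p q
        = LinearMap.ker C.d' ⊓ LinearMap.range C.d'' ⊓ C.A p q ∧
      LinearMap.range C.d' ⊓ LinearMap.ker C.d'' ⊓ C.A p q
        = LinearMap.range (C.d' ∘ₗ C.d'') ⊓ C.A p q

lemma F_eq_sup (p n : ℤ) : C.F p n = C.A p (n - p) ⊔ C.F (p + 1) n := by
  apply le_antisymm
  · refine iSup₂_le fun s hs => ?_
    rcases hs.eq_or_lt with rfl | hlt
    · exact le_sup_left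
    · exact le_sup_of_le_right (le_iSup₂_of_le s (by omega) le_rfl)
  · exact sup_le (le_iSup₂_of_le p le_rfl le_rfl) (C.F_antitone (by omega) n)

lemma A_le_F {p s n t : ℤ} (hs : p ≤ s) (ht : s + t = n) : C.A s t ≤ C.F p n := by
  obtain rfl : t = n - s := by omega
  exact le_iSup₂_of_le s hs le_rfl

lemma d'_mem {p q p₁ : ℤ} (hp : p₁ = p + 1) {x : V} (hx : x ∈ C.A p q) :
    C.d' x ∈ C.A p₁ q :=
  hp ▸ C.mapA_d' p q (Submodule.mem_map_of_mem hx)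

lemma d''_mem {p q q₁ : ℤ} (hq : q₁ = q + 1) {x : V} (hx : x ∈ C.A p q) :
    C.d'' x ∈ C.A p q₁ :=
  hq ▸ C.mapA_d'' p q (Submodule.mem_map_of_mem hx)

lemma dTot_mem_F {p n n₁ : ℤ} (hn : n₁ = n + 1) {x : V} (hx : x ∈ C.F p n) :
    C.dTot x ∈ C.F p n₁ := by
  suffices C.F p n ≤ (C.F p n₁).comap C.dTot from this hx
  refine iSup₂_le fun s hs y hy => ?_
  exact add_mem (C.A_le_F (by omega) (by omega) (C.d'_mem rfl hy))
    (C.A_le_F hs (by omega) (C.d''_mem rfl hy))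

/-- Elements of total degree `n` are determined by their components of first degree `≥ p`
and of first degree `< p`. -/
lemma disjoint_F_biSup_lt (p n : ℤ) :
    Disjoint (C.F p n) (⨆ (s : ℤ) (_ : s < p), C.A s (n - s)) := by
  have hind : iSupIndep fun s : ℤ => C.A s (n - s) :=
    C.isInternal.submodule_iSupIndep.comp (f := fun s : ℤ => (s, n - s))
      fun s t hst => congrArg Prod.fst hst
  refine hind.disjoint_biSup_biSup (s := Set.Ici p) (t := Set.Iio p) ?_
  exact Set.disjoint_left.mpr fun s hs hs' => not_lt.mpr (Set.mem_Ici.mp hs) hs'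

/-- Splitting off the first `m` homogeneous components of an element of the filtration. -/
lemma exists_components {p n : ℤ} {x : V} (hx : x ∈ C.F p n) (m : ℕ) :
    ∃ c : ℕ → V, (∀ i : ℕ, c i ∈ C.A (p + i) (n - p - i)) ∧
      x - ∑ i ∈ Finset.range m, c i ∈ C.F (p + m) n := by
  induction m with
  | zero => exact ⟨0, fun i => zero_mem _, by simpa using hx⟩
  | succ m ih =>
    obtain ⟨c, hc, hm⟩ := ih
    rw [F_eq_sup, Submodule.mem_sup] at hm
    obtain ⟨a, ha, y, hy, hay⟩ := hm
    refine ⟨Function.update c m a, fun i => ?_, ?_⟩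
    · rcases eq_or_ne i m with rfl | hi
      · rw [Function.update_self, show n - p - (i : ℤ) = n - (p + i) by ring]
        exact ha
      · rw [Function.update_of_ne hi]
        exact hc i
    · have hsum : ∑ i ∈ Finset.range m, Function.update c m a i = ∑ i ∈ Finset.range m, c i :=
        Finset.sum_congr rfl fun i hi =>
          Function.update_of_ne (Finset.mem_range.mp hi).ne _ _
      rw [Finset.sum_range_succ, hsum, Function.update_self, ← sub_sub, ← hay,
        add_sub_cancel_left, Nat.cast_succ, ← add_assoc]
      exact hy

/-- A homogeneous element in the image of `d''` is the image of a homogeneous element. -/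
lemma exists_homogeneous_preimage_d'' {p q : ℤ} {x : V} (hx : x ∈ C.A p (q + 1))
    (hx' : x ∈ LinearMap.range C.d'') : ∃ w ∈ C.A p q, C.d'' w = x := by
  obtain ⟨v, rfl⟩ := hx'
  have hle : (⊤ : Submodule k V) ≤
      C.A p q ⊔ (⨆ (i : ℤ × ℤ) (_ : i ≠ (p, q + 1)), C.A i.1 i.2).comap C.d'' := by
    rw [← C.isInternal.submodule_iSup_eq_top]
    refine iSup_le fun i => ?_
    by_cases hi : i = (p, q)
    · subst hi
      exact le_sup_left
    · refine le_sup_of_le_right fun y hy => ?_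
      have hne : (i.1, i.2 + 1) ≠ (p, q + 1) := fun h => hi (by
        simp only [Prod.mk.injEq, add_left_inj] at h
        exact Prod.ext h.1 h.2)
      exact le_iSup₂ (f := fun (i : ℤ × ℤ) (_ : i ≠ (p, q + 1)) => C.A i.1 i.2)
        (i.1, i.2 + 1) hne (C.d''_mem rfl hy)
  obtain ⟨w, hw, u, hu, rfl⟩ := Submodule.mem_sup.mp (hle (Submodule.mem_top (x := v)))
  refine ⟨w, hw, ?_⟩
  have hzero : C.d'' u = 0 := by
    refine Submodule.disjoint_def.mp (C.isInternal.submodule_iSupIndep (p, q + 1)) _ ?_ hu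
    have := sub_mem hx (C.d''_mem rfl hw)
    rwa [map_add, add_sub_cancel_left] at this
  rw [map_add, hzero, add_zero]

/-- If `d` of an element lies in the filtration step just above its first `m + 1` components,
then `d` of their sum is `d'` of the last one. -/
lemma dTot_sum_components {p n : ℤ} {m : ℕ} {c : ℕ → V} {x : V}
    (hc : ∀ i : ℕ, c i ∈ C.A (p + i) (n - p - i))
    (hx : x - ∑ i ∈ Finset.range (m + 1), c i ∈ C.F (p + m + 1) n)
    (hdx : C.dTot x ∈ C.F (p + m + 1) (n + 1)) :
    C.dTot (∑ i ∈ Finset.range (m + 1), c i) = C.d' (c m) := by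
  have hlow : ∀ {s t : ℤ}, s < p + m + 1 → s + t = n + 1 →
      C.A s t ≤ ⨆ (s : ℤ) (_ : s < p + m + 1), C.A s (n + 1 - s) := by
    intro s t hs ht
    obtain rfl : t = n + 1 - s := by omega
    exact le_iSup₂ (f := fun (s : ℤ) (_ : s < p + m + 1) => C.A s (n + 1 - s)) s hs
  refine sub_eq_zero.mp (Submodule.disjoint_def.mp
    (C.disjoint_F_biSup_lt (p + m + 1) (n + 1)) _ ?_ ?_)
  · refine sub_mem ?_ (C.A_le_F le_rfl (by omega) (C.d'_mem rfl (hc m)))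
    have := sub_mem hdx (C.dTot_mem_F rfl hx)
    rwa [map_sub, sub_sub_cancel] at this
  · rw [Finset.sum_range_succ, map_add, dTot, LinearMap.add_apply _ _ (c m), map_sum,
      add_sub_assoc, add_sub_cancel_left]
    refine add_mem (Submodule.sum_mem _ fun i hi => ?_)
      (hlow (by omega) (by omega) (C.d''_mem rfl (hc m)))
    have hi' := Finset.mem_range.mp hi
    exact add_mem (hlow (by omega) (by omega) (C.d'_mem rfl (hc i)))
      (hlow (by omega) (by omega) (C.d''_mem rfl (hc i)))

/-- The kernel of `β_{p,q,r}` vanishes because boundaries in `B^{p,q}_r` already lie in the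
denominator of `E^{p,q}_r`. -/
lemma B_le_Eden_of_scrE_eq_empty (r : ℤ) (hr : 1 ≤ r) (p q : ℤ)
    (h : C.scrE (p - r) (q + r - 1) r = ∅) : C.B p q r ≤ C.Eden p q r := by
  obtain ⟨m, rfl⟩ : ∃ m : ℕ, r = m + 1 := ⟨(r - 1).toNat, by omega⟩
  have hm : ((m : ℤ) + 1).toNat = m + 1 := by omega
  rintro b ⟨hbF, η, hη, rfl⟩
  obtain ⟨c, hc, hηc⟩ := C.exists_components hη (m + 1)
  rw [show p - (m + 1 : ℤ) + ((m + 1 : ℕ) : ℤ) = p by push_cast; ring] at hηc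
  have hp : p - (m + 1 : ℤ) + m + 1 = p := by ring
  have hdξ := C.dTot_sum_components hc (by rwa [hp]) (by rwa [hp, sub_add_cancel])
  by_cases him : C.d' (c m) ∈ LinearMap.range C.d''
  · have hdc : C.d' (c m) ∈ C.A p (q - 1 + 1) := by
      have := C.d'_mem hp.symm (hc m)
      rwa [show p + q - 1 - (p - (m + 1 : ℤ)) - m = q - 1 + 1 by ring] at this
    obtain ⟨w, hw, hdw⟩ := C.exists_homogeneous_preimage_d'' hdc him
    set y := η - ∑ i ∈ Finset.range (m + 1), c i with hy
    have hwy : w + y ∈ C.F p (p + q - 1) :=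
      add_mem (C.A_le_F le_rfl (by omega) hw) hηc
    have hdiff : C.dTot η - C.dTot (w + y) = -C.d' w := by
      rw [map_add, hy, map_sub, hdξ, ← hdw, dTot]
      simp only [LinearMap.add_apply]
      abel
    rw [← sub_add_cancel (C.dTot η) (C.dTot (w + y))]
    refine Submodule.add_mem_sup ⟨?_, ?_⟩ ⟨C.dTot_mem_F (by omega) hwy, ?_⟩
    · rw [hdiff]
      exact neg_mem (C.A_le_F le_rfl (by omega) (C.d'_mem rfl hw))
    · rw [SetLike.mem_coe, Submodule.mem_comap, map_sub, C.dd_apply, C.dd_apply, sub_zero]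
      exact zero_mem _
    · exact Submodule.mem_map_of_mem (C.F_antitone (by omega) _ hwy)
  · by_contra hb
    refine Set.eq_empty_iff_forall_notMem.mp h (∑ i ∈ Finset.range (m + 1), c i) ?_
    rw [scrE, if_pos hr]
    have hdeg : p - (m + 1 : ℤ) + (q + (m + 1) - 1) = p + q - 1 := by ring
    refine ⟨c, fun i => ?_, by rw [hm], by rw [hm]; exact hdξ, by rw [hm]; exact him, ?_⟩
    · rw [show q + (m + 1 : ℤ) - 1 - i = p + q - 1 - (p - (m + 1)) - i by ring]
      exact hc i
    · rintro ⟨ζ, -, hdζ, hζc⟩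
      rw [hdeg] at hζc
      have hη0 : η - c 0 ∈ C.F (p - (m + 1 : ℤ) + 1) (p + q - 1) := by
        have htail : ∑ i ∈ Finset.range m, c (i + 1) ∈
            C.F (p - (m + 1 : ℤ) + 1) (p + q - 1) :=
          Submodule.sum_mem _ fun i _ =>
            C.A_le_F (by push_cast; omega) (by push_cast; omega) (hc (i + 1))
        rw [show η - c 0 = η - ∑ i ∈ Finset.range (m + 1), c i +
          ∑ i ∈ Finset.range m, c (i + 1) by rw [Finset.sum_range_succ']; abel]
        exact add_mem (C.F_antitone (by omega) _ hηc) htail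
      refine hb (Submodule.mem_sup_right ⟨hbF, η - ζ, ?_, by rw [map_sub, hdζ, sub_zero]⟩)
      have := sub_mem hη0 hζc
      rwa [sub_sub_sub_cancel_right,
        show p - (m + 1 : ℤ) + 1 = p - (m + 1 - 1) by ring] at this

theorem statement_12 (r : ℤ) (hr : 1 ≤ r) (p q : ℤ)
    (h : C.scrE (p - r) (q + r - 1) r = ∅) : Function.Bijective ⇑(C.beta p q r) := by
  constructor
  · rw [← LinearMap.ker_eq_bot, beta, Submodule.mapQ, Submodule.ker_liftQ_eq_bot]
    rw [LinearMap.comp_id, Submodule.ker_mkQ]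
    exact Submodule.comap_mono
      (sup_le le_sup_left (C.B_le_Eden_of_scrE_eq_empty r hr p q h))
  · intro y
    obtain ⟨x, rfl⟩ := Submodule.mkQ_surjective _ y
    exact ⟨Submodule.Quotient.mk x, rfl⟩

end DoubleComplex
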